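/- Let n ≥ 2 and let λ₁, Λ₁, λ₂, Λ₂ be positive constants with λ_l ≤ Λ_l, and set N_l = (λ_l/Λ_l)(n−1) + 1 for l = 1, 2. Assume N₁ > 2, N₂ > 2, p ≥ 1, q ≥ 1 and pq > 1, and that either 2(p+1)/(pq−1) ≥ N₁−2 or 2(q+1)/(pq−1) ≥ N₂−2. Then there is no pair of continuous positive functions u₁, u₂ : ℝⁿ → (0,∞) such that u₁ is a viscosity supersolution of M⁺_{λ₁,Λ₁}(D²u₁) + u₂^p = 0 in ℝⁿ and u₂ is a viscosity supersolution of M⁺_{λ₂,Λ₂}(D²u₂) + u₁^q = 0 in ℝⁿ. -/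

import Mathlib

open scoped BigOperators

/-- The Pucci maximal operator `M⁺_{λ,Λ}`: for a symmetric matrix it equals
`Λ · (sum of positive eigenvalues) + λ · (sum of negative eigenvalues)`. -/
noncomputable def pucciMax (lam Lam : ℝ) {n : ℕ} (M : Matrix (Fin n) (Fin n) ℝ) : ℝ :=
  if h : M.IsHermitian then
    ∑ i, (Lam * max (h.eigenvalues i) 0 + lam * min (h.eigenvalues i) 0)
  else 0

/-- The Hessian matrix of `φ` at `x`. -/
noncomputable def hess {n : ℕ} (φ : EuclideanSpace ℝ (Fin n) → ℝ)
    (x : EuclideanSpace ℝ (Fin n)) : Matrix (Fin n) (Fin n) ℝ :=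
  fun i j => iteratedFDeriv ℝ 2 φ x ![EuclideanSpace.single i 1, EuclideanSpace.single j 1]

/-- `u` is a viscosity supersolution of `M⁺_{λ,Λ}(D²u) + g = 0` in `Ω`. -/
def PucciSupersol (lam Lam : ℝ) {n : ℕ} (Ω : Set (EuclideanSpace ℝ (Fin n)))
    (u g : EuclideanSpace ℝ (Fin n) → ℝ) : Prop :=
  ∀ x₀ ∈ Ω, ∀ φ : EuclideanSpace ℝ (Fin n) → ℝ, ContDiff ℝ 2 φ →
    IsLocalMin (fun x => u x - φ x) x₀ → pucciMax lam Lam (hess φ x₀) + g x₀ ≤ 0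

open Filter Topology

theorem pucciMax_ge {n : ℕ} {lam Lam : ℝ} (hle : lam ≤ Lam)
    {M : Matrix (Fin n) (Fin n) ℝ} (hM : M.IsHermitian)
    (w : EuclideanSpace ℝ (Fin n)) (hw : ‖w‖ ≤ 1) :
    lam * M.trace + (Lam - lam) * (w.ofLp ⬝ᵥ (M.mulVec w.ofLp)) ≤ pucciMax lam Lam M := by
  have hq : w.ofLp ⬝ᵥ (M.mulVec w.ofLp)
      = ∑ i, hM.eigenvalues i * (inner ℝ (hM.eigenvectorBasis i) w) ^ 2 := by
    have h1 : w.ofLp ⬝ᵥ (M.mulVec w.ofLp) = inner ℝ w (Matrix.toEuclideanLin M w) := by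
      rw [EuclideanSpace.inner_eq_star_dotProduct]
      simp [dotProduct_comm]
    rw [h1, ← hM.eigenvectorBasis.sum_inner_mul_inner]
    refine Finset.sum_congr rfl fun i _ => ?_
    have h2 : inner ℝ (hM.eigenvectorBasis i) (Matrix.toEuclideanLin M w)
        = hM.eigenvalues i * inner ℝ (hM.eigenvectorBasis i) w := by
      have hs := (Matrix.isSymmetric_toEuclideanLin_iff.2 hM) (hM.eigenvectorBasis i) w
      rw [← hs]
      have h3 : Matrix.toEuclideanLin M (hM.eigenvectorBasis i)
          = hM.eigenvalues i • hM.eigenvectorBasis i := by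
        ext j
        have := congrFun (hM.mulVec_eigenvectorBasis i) j
        simpa using this
      rw [h3, real_inner_smul_left]
    rw [h2, real_inner_comm]
    ring
  have htr : M.trace = ∑ i, hM.eigenvalues i := by
    simpa using hM.trace_eq_sum_eigenvalues
  have hle1 : ∀ i, (inner ℝ (hM.eigenvectorBasis i) w) ^ 2 ≤ 1 := by
    intro i
    have := abs_real_inner_le_norm (hM.eigenvectorBasis i) w
    rw [hM.eigenvectorBasis.orthonormal.1 i, one_mul] at this
    rw [sq_le_one_iff_abs_le_one]
    exact this.trans hw
  rw [pucciMax, dif_pos hM, hq, htr, Finset.mul_sum, Finset.mul_sum, ← Finset.sum_add_distrib]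
  refine Finset.sum_le_sum fun i _ => ?_
  set e := hM.eigenvalues i
  have ha := hle1 i
  have hb := sq_nonneg (inner ℝ (hM.eigenvectorBasis i) w)
  set a := (inner ℝ (hM.eigenvectorBasis i) w) ^ 2
  have hd : 0 ≤ Lam - lam := sub_nonneg.2 hle
  rcases le_total 0 e with h | h
  · rw [max_eq_left h, min_eq_right h]
    nlinarith [mul_nonneg (mul_nonneg hd h) (sub_nonneg.2 ha)]
  · rw [max_eq_right h, min_eq_left h]
    nlinarith [mul_nonneg (mul_nonneg hd (neg_nonneg.2 h)) hb]

theorem hess_radial {n : ℕ} {F F' F'' : ℝ → ℝ}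
    (hF : ∀ s, 0 ≤ s → HasDerivAt F (F' s) s)
    (hF' : ∀ s, 0 ≤ s → HasDerivAt F' (F'' s) s) (x : EuclideanSpace ℝ (Fin n)) :
    hess (fun y => F (‖y‖ ^ 2)) x
      = (2 * F' (‖x‖ ^ 2)) • (1 : Matrix (Fin n) (Fin n) ℝ)
        + (4 * F'' (‖x‖ ^ 2)) • Matrix.vecMulVec x.ofLp x.ofLp := by
  obtain ⟨B, hB⟩ : ∃ B : EuclideanSpace ℝ (Fin n) →L[ℝ] EuclideanSpace ℝ (Fin n) →L[ℝ] ℝ,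
      ∀ y z, B y z = inner ℝ y z := ⟨isBoundedBilinearMap_inner.toContinuousLinearMap, fun _ _ => rfl⟩
  have hsq : ∀ y : EuclideanSpace ℝ (Fin n), HasFDerivAt (fun y => ‖y‖ ^ 2) (2 • B y) y := by
    intro y
    have h := (hasStrictFDerivAt_norm_sq y).hasFDerivAt
    have hy : B y = innerSL ℝ y := by ext z; simp [hB]
    rwa [hy]
  have h1 : fderiv ℝ (fun y : EuclideanSpace ℝ (Fin n) => F (‖y‖ ^ 2))
      = fun y => (2 * F' (‖y‖ ^ 2)) • B y := by
    funext y
    have := (hF _ (sq_nonneg ‖y‖)).comp_hasFDerivAt y (hsq y)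
    refine this.fderiv.trans ?_
    ext v
    simp [hB]
    ring
  have h2 : HasFDerivAt (fun y : EuclideanSpace ℝ (Fin n) => (2 * F' (‖y‖ ^ 2)) • B y)
      ((2 * F' (‖x‖ ^ 2)) • B
        + ((2 : ℝ) • (F'' (‖x‖ ^ 2) • (2 • B x))).smulRight (B x)) x := by
    have ha := ((hF' _ (sq_nonneg ‖x‖)).comp_hasFDerivAt x (hsq x)).const_mul 2
    exact ha.smul B.hasFDerivAt
  ext i j
  rw [hess, iteratedFDeriv_two_apply, h1, h2.fderiv]
  rcases eq_or_ne i j with rfl | hij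
  · simp [hB, Matrix.vecMulVec_apply, EuclideanSpace.inner_single_right]
    ring
  · simp [hB, Matrix.vecMulVec_apply, EuclideanSpace.inner_single_right, hij, hij.symm]
    ring

theorem le_pucciMax_hess_radial {n : ℕ} (hn : 0 < n) {lam Lam N : ℝ} (hle : lam ≤ Lam)
    (hN : Lam * N = lam * ((n : ℝ) - 1) + Lam) {F F' F'' : ℝ → ℝ}
    (hF : ∀ s, 0 ≤ s → HasDerivAt F (F' s) s)
    (hF' : ∀ s, 0 ≤ s → HasDerivAt F' (F'' s) s) (x : EuclideanSpace ℝ (Fin n)) :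
    Lam * (4 * ‖x‖ ^ 2 * F'' (‖x‖ ^ 2) + 2 * N * F' (‖x‖ ^ 2))
      ≤ pucciMax lam Lam (hess (fun y => F (‖y‖ ^ 2)) x) := by
  rw [hess_radial hF hF']
  set a := 2 * F' (‖x‖ ^ 2) with ha
  set b := 4 * F'' (‖x‖ ^ 2) with hb
  obtain ⟨w, hw, hxw⟩ : ∃ w : EuclideanSpace ℝ (Fin n), ‖w‖ = 1 ∧ x = ‖x‖ • w := by
    by_cases hx : x = 0
    · exact ⟨EuclideanSpace.single ⟨0, hn⟩ 1, by simp, by simp [hx]⟩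
    · have hx' : ‖x‖ ≠ 0 := norm_ne_zero_iff.2 hx
      refine ⟨‖x‖⁻¹ • x, ?_, ?_⟩
      · rw [norm_smul, norm_inv, norm_norm, inv_mul_cancel₀ hx']
      · rw [smul_smul, mul_inv_cancel₀ hx', one_smul]
  have hM : (a • (1 : Matrix (Fin n) (Fin n) ℝ)
      + b • Matrix.vecMulVec x.ofLp x.ofLp).IsHermitian := by
    ext i j
    simp [Matrix.vecMulVec_apply, Matrix.one_apply, eq_comm, mul_comm]
  refine le_trans (le_of_eq ?_) (pucciMax_ge hle hM w hw.le)
  have hdot : ∀ y z : EuclideanSpace ℝ (Fin n), y.ofLp ⬝ᵥ z.ofLp = inner ℝ y z := by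
    intro y z
    rw [EuclideanSpace.inner_eq_star_dotProduct]
    simp [dotProduct_comm]
  have hww : w.ofLp ⬝ᵥ w.ofLp = 1 := by
    rw [hdot, real_inner_self_eq_norm_sq, hw, one_pow]
  have hxx : x.ofLp ⬝ᵥ x.ofLp = ‖x‖ ^ 2 := by
    rw [hdot, real_inner_self_eq_norm_sq]
  have hwx : w.ofLp ⬝ᵥ x.ofLp = ‖x‖ := by
    rw [hdot]
    nth_rewrite 1 [hxw]
    rw [real_inner_smul_right, real_inner_self_eq_norm_sq, hw, one_pow, mul_one]
  have hxw' : x.ofLp ⬝ᵥ w.ofLp = ‖x‖ := by rw [dotProduct_comm, hwx]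
  rw [Matrix.trace_add, Matrix.trace_smul, Matrix.trace_smul, Matrix.trace_one,
    Matrix.trace_vecMulVec, Matrix.add_mulVec, Matrix.smul_mulVec, Matrix.smul_mulVec,
    Matrix.one_mulVec, Matrix.vecMulVec_mulVec, dotProduct_add, dotProduct_smul, dotProduct_smul,
    hxw', hww, hxx]
  simp only [op_smul_eq_smul, dotProduct_smul, hwx, smul_eq_mul, Fintype.card_fin,
    mul_one]
  have h1 : 2 * N * F' (‖x‖ ^ 2) = N * a := by rw [ha]; ring
  have h2 : 4 * ‖x‖ ^ 2 * F'' (‖x‖ ^ 2) = ‖x‖ ^ 2 * b := by rw [hb]; ring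
  rw [h1, h2]
  linear_combination a * hN

theorem PucciSupersol.radial_le {n : ℕ} (hn : 0 < n) {lam Lam N : ℝ} (hle : lam ≤ Lam)
    (hN : Lam * N = lam * ((n : ℝ) - 1) + Lam) {u g : EuclideanSpace ℝ (Fin n) → ℝ}
    (hu : Continuous u) (hpos : ∀ x, 0 < u x) (hsup : PucciSupersol lam Lam Set.univ u g)
    {F F' F'' : ℝ → ℝ} (hF : ∀ s, 0 ≤ s → HasDerivAt F (F' s) s)
    (hF' : ∀ s, 0 ≤ s → HasDerivAt F' (F'' s) s)
    (hC : ContDiff ℝ 2 fun x : EuclideanSpace ℝ (Fin n) => F (‖x‖ ^ 2))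
    (hlim : ∀ ε > 0, ∀ᶠ s in atTop, F s ≤ ε)
    (hL : ∀ x, u x < F (‖x‖ ^ 2) →
      0 < Lam * (4 * ‖x‖ ^ 2 * F'' (‖x‖ ^ 2) + 2 * N * F' (‖x‖ ^ 2)) + g x)
    (x : EuclideanSpace ℝ (Fin n)) : F (‖x‖ ^ 2) ≤ u x := by
  by_contra! hx
  have hlim' : ∀ᶠ y : EuclideanSpace ℝ (Fin n) in cocompact _,
      u x - F (‖x‖ ^ 2) ≤ u y - F (‖y‖ ^ 2) := by
    have h1 : Tendsto (fun y : EuclideanSpace ℝ (Fin n) => ‖y‖ ^ 2) (cocompact _) atTop :=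
      (tendsto_pow_atTop two_ne_zero).comp (tendsto_norm_cocompact_atTop (E := _))
    filter_upwards [h1.eventually (hlim _ (sub_pos.2 hx))] with y hy
    linarith [hpos y]
  obtain ⟨y, hy⟩ := (hu.sub hC.continuous).exists_forall_le' x hlim'
  have h1 := hsup y (Set.mem_univ _) _ hC (Filter.Eventually.of_forall fun z => hy z)
  have h2 := le_pucciMax_hess_radial hn hle hN hF hF' y
  have h3 := hL y (by have := hy x; simp only [Pi.sub_apply] at this; linarith)
  linarith

theorem hasDerivAt_one_add_mul_rpow {k s : ℝ} (h : 0 < 1 + k * s) (e : ℝ) :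
    HasDerivAt (fun s => (1 + k * s) ^ e) (k * e * (1 + k * s) ^ (e - 1)) s := by
  have h1 : HasDerivAt (fun s => 1 + k * s) k s := by
    simpa using ((hasDerivAt_id s).const_mul k).const_add 1
  exact h1.rpow_const (Or.inl h.ne')

theorem contDiff_one_add_mul_norm_sq_rpow {n : ℕ} {k : ℝ} (hk : 0 ≤ k) (e : ℝ) :
    ContDiff ℝ 2 fun x : EuclideanSpace ℝ (Fin n) => (1 + k * ‖x‖ ^ 2) ^ e :=
  (contDiff_const.add (contDiff_const.mul (contDiff_norm_sq ℝ))).rpow_const_of_ne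
    fun x => by positivity

theorem tendsto_one_add_mul_rpow_neg {k e : ℝ} (hk : 0 < k) (he : e < 0) :
    Tendsto (fun s : ℝ => (1 + k * s) ^ e) atTop (𝓝 0) := by
  have h1 : Tendsto (fun s : ℝ => 1 + k * s) atTop atTop :=
    tendsto_atTop_add_const_left _ _ (tendsto_id.const_mul_atTop hk)
  have h2 := (tendsto_rpow_neg_atTop (neg_pos.2 he)).comp h1
  simpa [Function.comp_def] using h2

theorem PucciSupersol.power_le {n : ℕ} (hn : 0 < n) {lam Lam c : ℝ} (hle : lam ≤ Lam)
    (hLam : 0 < Lam) (hc : 0 < c) (hN : Lam * (2 * c + 2) = lam * ((n : ℝ) - 1) + Lam)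
    {u g : EuclideanSpace ℝ (Fin n) → ℝ} (hu : Continuous u) (hpos : ∀ x, 0 < u x)
    (hg : ∀ x, 0 ≤ g x) (hsup : PucciSupersol lam Lam Set.univ u g)
    {S m : ℝ} (hS : 0 < S) (hm : 0 < m) (hmu : ∀ y, ‖y‖ ^ 2 ≤ S → m ≤ u y)
    (x : EuclideanSpace ℝ (Fin n)) :
    m / (c + 2) * (1 + (c + (c + 1) ^ 2) / S * ‖x‖ ^ 2) ^ (-c) ≤ u x := by
  set k := (c + (c + 1) ^ 2) / S with hk
  have hk0 : 0 < k := by positivity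
  set A := m / (c + 2) with hA
  have hA0 : 0 < A := by positivity
  have hAm : A * (c + 2) = m := by rw [hA]; field_simp
  have ht : ∀ s : ℝ, 0 ≤ s → 0 < 1 + k * s := fun s hs => by positivity
  have key := hsup.radial_le (N := 2 * c + 2) hn hle hN hu hpos
    (F := fun s => A * ((1 + k * s) ^ (-c) + (c + 1) * (1 + k * s) ^ (-c - 1)))
    (F' := fun s => A * (k * (-c) * (1 + k * s) ^ (-c - 1)
      + (c + 1) * (k * (-c - 1) * (1 + k * s) ^ (-c - 1 - 1))))
    (F'' := fun s => A * (k * (-c) * (k * (-c - 1) * (1 + k * s) ^ (-c - 1 - 1))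
      + (c + 1) * (k * (-c - 1) * (k * (-c - 1 - 1) * (1 + k * s) ^ (-c - 1 - 1 - 1)))))
    (fun s hs => ((hasDerivAt_one_add_mul_rpow (ht s hs) _).add
      ((hasDerivAt_one_add_mul_rpow (ht s hs) _).const_mul _)).const_mul _)
    (fun s hs => (((hasDerivAt_one_add_mul_rpow (ht s hs) _).const_mul _).add
      (((hasDerivAt_one_add_mul_rpow (ht s hs) _).const_mul _).const_mul _)).const_mul _)
    (contDiff_const.mul ((contDiff_one_add_mul_norm_sq_rpow hk0.le _).add
      (contDiff_const.mul (contDiff_one_add_mul_norm_sq_rpow hk0.le _))))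
    (by
      intro ε hε
      have h1 := ((tendsto_one_add_mul_rpow_neg hk0 (neg_neg_of_pos hc)).add
        ((tendsto_one_add_mul_rpow_neg hk0 (by linarith : -c - 1 < 0)).const_mul (c + 1))).const_mul A
      exact h1.eventually_le_const (by simpa using hε))
    (by
      intro y hy
      have hyS : S < ‖y‖ ^ 2 := by
        by_contra! hyS
        refine absurd hy (not_lt.2 ((le_trans ?_ hAm.le).trans (hmu y hyS)))
        have h1 : 1 ≤ 1 + k * ‖y‖ ^ 2 := le_add_of_nonneg_right (by positivity)
        have h2 : (1 + k * ‖y‖ ^ 2) ^ (-c) ≤ 1 :=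
          Real.rpow_le_one_of_one_le_of_nonpos h1 (by linarith)
        have h3 : (1 + k * ‖y‖ ^ 2) ^ (-c - 1) ≤ 1 :=
          Real.rpow_le_one_of_one_le_of_nonpos h1 (by linarith)
        refine mul_le_mul_of_nonneg_left ?_ hA0.le
        nlinarith
      refine add_pos_of_pos_of_nonneg (mul_pos hLam ?_) (hg y)
      have hτ : c + (c + 1) ^ 2 < k * ‖y‖ ^ 2 := by
        rw [hk, div_mul_eq_mul_div, lt_div_iff₀ hS]
        exact mul_lt_mul_of_pos_left hyS (by positivity)
      have ht0 := ht _ (sq_nonneg ‖y‖)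
      set t := 1 + k * ‖y‖ ^ 2 with htdef
      have hw : 0 < t ^ (-c - 1 - 1 - 1) := Real.rpow_pos_of_pos ht0 _
      have e1 : t ^ (-c - 1 - 1) = t ^ (-c - 1 - 1 - 1) * t := by
        rw [← Real.rpow_add_one ht0.ne']; ring_nf
      have e2 : t ^ (-c - 1) = t ^ (-c - 1 - 1 - 1) * t * t := by
        rw [← e1, ← Real.rpow_add_one ht0.ne']; ring_nf
      rw [e1, e2]
      set w := t ^ (-c - 1 - 1 - 1)
      have h := mul_pos (mul_pos (mul_pos (mul_pos four_pos hA0) hk0) hw)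
        (mul_pos (by linarith : 0 < c + 1) (sub_pos.2 hτ))
      refine h.trans_le (le_of_eq ?_)
      rw [htdef]
      ring)
    x
  refine le_trans (mul_le_mul_of_nonneg_left ?_ hA0.le) key
  have := Real.rpow_pos_of_pos (ht _ (sq_nonneg ‖x‖)) (-c - 1)
  exact le_add_of_nonneg_right (by positivity)

theorem PucciSupersol.paraboloid_le {n : ℕ} (hn : 0 < n) {lam Lam N : ℝ} (hle : lam ≤ Lam)
    (hLam : 0 < Lam) (hN0 : 0 < N) (hN : Lam * N = lam * ((n : ℝ) - 1) + Lam)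
    {u g : EuclideanSpace ℝ (Fin n) → ℝ} (hu : Continuous u) (hpos : ∀ x, 0 < u x)
    (hsup : PucciSupersol lam Lam Set.univ u g)
    {S k : ℝ} (hk : 0 < k) (hkg : ∀ y, ‖y‖ ^ 2 ≤ 4 * S → k ≤ g y)
    (x : EuclideanSpace ℝ (Fin n)) (hx : ‖x‖ ^ 2 ≤ S) :
    3 / (4 * N * Lam) * S * k ≤ u x := by
  set A := k / (4 * N * Lam) with hA
  have hA0 : 0 < A := by positivity
  have hAk : Lam * (2 * N * A) = k / 2 := by rw [hA]; field_simp; norm_num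
  have key := hsup.radial_le (N := N) hn hle hN hu hpos
    (F := fun s => A * (4 * S - s)) (F' := fun _ => -A) (F'' := fun _ => 0)
    (fun s _ => by simpa using ((hasDerivAt_id s).const_sub (4 * S)).const_mul A)
    (fun s _ => hasDerivAt_const s _)
    (contDiff_const.mul (contDiff_const.sub (contDiff_norm_sq ℝ)))
    (by
      intro ε hε
      filter_upwards [eventually_ge_atTop (4 * S)] with s hs
      nlinarith)
    (by
      intro y hy
      have h1 : ‖y‖ ^ 2 ≤ 4 * S := by
        by_contra! h
        have := hpos y
        nlinarith
      have h2 := hkg y h1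
      nlinarith)
    x
  refine le_trans ?_ key
  have h3 : 3 / (4 * N * Lam) * S * k = A * (3 * S) := by rw [hA]; ring
  rw [h3]
  exact mul_le_mul_of_nonneg_left (by linarith) hA0.le

theorem PucciSupersol.power_log_le {n : ℕ} (hn : 0 < n) {lam Lam c : ℝ} (hle : lam ≤ Lam)
    (hLam : 0 < Lam) (hc : 0 < c) (hN : Lam * (2 * c + 2) = lam * ((n : ℝ) - 1) + Lam)
    {u g : EuclideanSpace ℝ (Fin n) → ℝ} (hu : Continuous u) (hpos : ∀ x, 0 < u x)
    (hsup : PucciSupersol lam Lam Set.univ u g)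
    {k : ℝ} (hk : 0 < k) (hkg : ∀ y, k * (1 + ‖y‖ ^ 2) ^ (-c - 1) ≤ g y) :
    ∃ A > 0, ∀ x, A * ((1 + ‖x‖ ^ 2) ^ (-c) * (1 / c + Real.log (1 + ‖x‖ ^ 2))) ≤ u x := by
  set A := k / (8 * Lam * c * (c + 2)) with hA
  have hA0 : 0 < A := by positivity
  have hAk : Lam * (4 * c * A * (c + 2)) = k / 2 := by rw [hA]; field_simp; norm_num
  refine ⟨A, hA0, ?_⟩
  have ht : ∀ s : ℝ, 0 ≤ s → 0 < 1 + s := fun s hs => by positivity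
  have hd : ∀ e s : ℝ, 0 ≤ s → HasDerivAt (fun s : ℝ => (1 + s) ^ e) (e * (1 + s) ^ (e - 1)) s := by
    intro e s hs
    simpa using hasDerivAt_one_add_mul_rpow (k := 1) (s := s) (by linarith) e
  have hl : ∀ s : ℝ, 0 ≤ s → HasDerivAt (fun s : ℝ => Real.log (1 + s)) (1 / (1 + s)) s := by
    intro s hs
    exact ((hasDerivAt_id s).const_add 1).log (ht s hs).ne'
  have hsub : ∀ e s : ℝ, 0 ≤ s → (1 + s) ^ e = (1 + s) ^ (e - 1) * (1 + s) := by
    intro e s hs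
    rw [← Real.rpow_add_one (ht s hs).ne', sub_add_cancel]
  refine hsup.radial_le (N := 2 * c + 2) hn hle hN hu hpos
    (F := fun s => A * ((1 + s) ^ (-c) * (1 / c + Real.log (1 + s))))
    (F' := fun s => A * (-c * ((1 + s) ^ (-c - 1) * Real.log (1 + s))))
    (F'' := fun s => A * (-c * ((-c - 1) * (1 + s) ^ (-c - 1 - 1) * Real.log (1 + s)
      + (1 + s) ^ (-c - 1 - 1))))
    ?_ ?_ ?_ ?_ ?_
  · intro s hs
    refine (((hd (-c) s hs).mul ((hl s hs).const_add (1 / c))).const_mul A).congr_deriv ?_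
    rw [hsub (-c) s hs]
    have := (ht s hs).ne'
    field_simp
    ring
  · intro s hs
    refine ((((hd (-c - 1) s hs).mul (hl s hs)).const_mul (-c)).const_mul A).congr_deriv ?_
    rw [hsub (-c - 1) s hs]
    have := (ht s hs).ne'
    field_simp
  · have h1 : ContDiff ℝ 2 fun x : EuclideanSpace ℝ (Fin n) => (1 + ‖x‖ ^ 2) ^ (-c) := by
      simpa using contDiff_one_add_mul_norm_sq_rpow (n := n) zero_le_one (-c)
    have h2 : ContDiff ℝ 2 fun x : EuclideanSpace ℝ (Fin n) => Real.log (1 + ‖x‖ ^ 2) :=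
      (contDiff_const.add (contDiff_norm_sq ℝ)).log fun x => by positivity
    exact contDiff_const.mul (h1.mul (contDiff_const.add h2))
  · intro ε hε
    have h0 : Tendsto (fun s : ℝ => 1 + s) atTop atTop :=
      tendsto_atTop_add_const_left _ _ tendsto_id
    have h1 := (tendsto_rpow_neg_atTop hc).comp h0
    have h2 := (isLittleO_log_rpow_atTop hc).tendsto_div_nhds_zero.comp h0
    have h3 := ((h1.mul_const (1 / c)).add h2).const_mul A
    have h4 := h3.eventually_le_const (u := ε) (by simpa using hε)
    filter_upwards [h4, eventually_ge_atTop 0] with s hs hs0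
    refine le_trans (le_of_eq ?_) hs
    simp only [Function.comp_apply]
    rw [Real.rpow_neg (ht s hs0).le]
    ring
  · intro y _
    have hg := hkg y
    have hl0 : Real.log (1 + ‖y‖ ^ 2) ≤ 1 + ‖y‖ ^ 2 := Real.log_le_self (by positivity)
    have hw : 0 < (1 + ‖y‖ ^ 2) ^ (-c - 1 - 1) := Real.rpow_pos_of_pos (by positivity) _
    rw [hsub (-c - 1) _ (sq_nonneg ‖y‖)] at hg ⊢
    set w := (1 + ‖y‖ ^ 2) ^ (-c - 1 - 1)
    set ℓ := Real.log (1 + ‖y‖ ^ 2)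
    have hs := sq_nonneg ‖y‖
    set s := ‖y‖ ^ 2
    have h1 : Lam * (4 * s * (A * (-c * ((-c - 1) * w * ℓ + w)))
        + 2 * (2 * c + 2) * (A * (-c * (w * (1 + s) * ℓ))))
        = - (Lam * (4 * c * A)) * w * ((c + 1) * ℓ + s) := by ring
    have h2 : Lam * (4 * c * A) * w * ((c + 1) * ℓ + s)
        ≤ Lam * (4 * c * A) * w * ((c + 2) * (1 + s)) := by
      refine mul_le_mul_of_nonneg_left ?_ (by positivity)
      nlinarith
    have h3 : Lam * (4 * c * A) * w * ((c + 2) * (1 + s)) = k / 2 * (w * (1 + s)) := by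
      rw [← hAk]; ring
    have h4 : 0 < k / 2 * (w * (1 + s)) := by positivity
    rw [h1]
    linarith

theorem rpow_neg_mul_log_antitone {c t T : ℝ} (hc : 0 < c) (ht : 1 ≤ t) (htT : t ≤ T) :
    T ^ (-c) * (1 / c + Real.log T) ≤ t ^ (-c) * (1 / c + Real.log t) := by
  have ht0 : 0 < t := by linarith
  have hT0 : 0 < T := by linarith
  have hl : 0 ≤ Real.log t := Real.log_nonneg ht
  have hlT : Real.log t ≤ Real.log T := Real.log_le_log ht0 htT
  set a := Real.log t with ha
  set b := Real.log T with hb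
  rw [Real.rpow_def_of_pos ht0, Real.rpow_def_of_pos hT0, ← ha, ← hb]
  have h1 : 1 / c + b ≤ (1 / c + a) * Real.exp (c * (b - a)) := by
    have h2 := Real.add_one_le_exp (c * (b - a))
    have h3 : 1 / c * c = 1 := by field_simp
    calc 1 / c + b ≤ (1 / c + a) * (c * (b - a) + 1) := by
          nlinarith [mul_nonneg hl (mul_nonneg hc.le (sub_nonneg.2 hlT))]
      _ ≤ _ := mul_le_mul_of_nonneg_left h2 (by positivity)
  calc Real.exp (b * -c) * (1 / c + b)
      ≤ Real.exp (b * -c) * ((1 / c + a) * Real.exp (c * (b - a))) :=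
        mul_le_mul_of_nonneg_left h1 (Real.exp_pos _).le
    _ = Real.exp (b * -c) * Real.exp (c * (b - a)) * (1 / c + a) := by ring
    _ = _ := by rw [← Real.exp_add]; ring_nf

theorem exists_min_norm_sq_le {n : ℕ} {u : EuclideanSpace ℝ (Fin n) → ℝ} (hu : Continuous u)
    {S : ℝ} (hS : 0 ≤ S) : ∃ z, ‖z‖ ^ 2 ≤ S ∧ ∀ y, ‖y‖ ^ 2 ≤ S → u z ≤ u y := by
  have hmem : ∀ y : EuclideanSpace ℝ (Fin n), y ∈ Metric.closedBall 0 √S ↔ ‖y‖ ^ 2 ≤ S := by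
    intro y
    rw [mem_closedBall_zero_iff, Real.le_sqrt (norm_nonneg y) hS]
  obtain ⟨z, hz, hmin⟩ := (isCompact_closedBall (0 : EuclideanSpace ℝ (Fin n)) √S).exists_isMinOn
    (Metric.nonempty_closedBall.2 (Real.sqrt_nonneg S)) hu.continuousOn
  exact ⟨z, (hmem z).1 hz, fun y hy => hmin ((hmem y).2 hy)⟩

theorem false_of_pucci_system {n : ℕ} (hn : 0 < n) {lam1 Lam1 lam2 Lam2 c N p q : ℝ}
    (hLam1 : 0 < Lam1) (hLam2 : 0 < Lam2) (hle1 : lam1 ≤ Lam1) (hle2 : lam2 ≤ Lam2)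
    (hc : 0 < c) (hN : 0 < N)
    (hc1 : Lam1 * (2 * c + 2) = lam1 * ((n : ℝ) - 1) + Lam1)
    (hN2 : Lam2 * N = lam2 * ((n : ℝ) - 1) + Lam2)
    (hp : 0 < p) (hq : 0 < q) (hpq : 1 < p * q) (hcrit : c * (p * q - 1) ≤ p + 1)
    {u1 u2 : EuclideanSpace ℝ (Fin n) → ℝ} (hu1 : Continuous u1) (hu2 : Continuous u2)
    (hpos1 : ∀ x, 0 < u1 x) (hpos2 : ∀ x, 0 < u2 x)
    (hsup1 : PucciSupersol lam1 Lam1 Set.univ u1 (fun x => u2 x ^ p))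
    (hsup2 : PucciSupersol lam2 Lam2 Set.univ u2 (fun x => u1 x ^ q)) : False := by
  have hg1 : ∀ x, 0 ≤ u2 x ^ p := fun x => (Real.rpow_pos_of_pos (hpos2 x) p).le
  set σ := c + (c + 1) ^ 2
  have hσ0 : 0 < σ := by positivity
  set d1 := 3 / (4 * (2 * c + 2) * Lam1)
  set d2 := 3 / (4 * N * Lam2)
  have hd1p : 0 < d1 := by positivity
  have hd2p : 0 < d2 := by positivity
  have par1 : ∀ {S k : ℝ}, 0 < k → (∀ y, ‖y‖ ^ 2 ≤ 4 * S → k ≤ u2 y ^ p) →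
      ∀ x, ‖x‖ ^ 2 ≤ S → d1 * S * k ≤ u1 x := fun hk h =>
    hsup1.paraboloid_le hn hle1 hLam1 (by linarith) hc1 hu1 hpos1 hk h
  have par2 : ∀ {S k : ℝ}, 0 < k → (∀ y, ‖y‖ ^ 2 ≤ 4 * S → k ≤ u1 y ^ q) →
      ∀ x, ‖x‖ ^ 2 ≤ S → d2 * S * k ≤ u2 x := fun hk h =>
    hsup2.paraboloid_le hn hle2 hLam2 hN hN2 hu2 hpos2 hk h
  obtain ⟨B, hB, hbase⟩ : ∃ B > 0, ∀ x, B * (1 + ‖x‖ ^ 2) ^ (-c) ≤ u1 x := by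
    obtain ⟨z, -, hz⟩ := exists_min_norm_sq_le hu1 zero_le_one
    have h := hsup1.power_le hn hle1 hLam1 hc hc1 hu1 hpos1 hg1 one_pos (hpos1 z) hz
    have hm := hpos1 z
    refine ⟨u1 z / (c + 2) * (1 + σ) ^ (-c), by positivity, fun x => le_trans ?_ (h x)⟩
    rw [mul_assoc, ← Real.mul_rpow (by positivity) (by positivity), div_one]
    refine mul_le_mul_of_nonneg_left ?_ (by positivity)
    refine Real.rpow_le_rpow_of_nonpos (by positivity) ?_ (by linarith)
    nlinarith [sq_nonneg ‖x‖]
  obtain ⟨k, hk, hsource⟩ : ∃ k > 0, ∀ x, k * (1 + ‖x‖ ^ 2) ^ (-c - 1) ≤ u2 x ^ p := by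
    refine ⟨(d2 * (B * 5 ^ (-c)) ^ q) ^ p, by positivity, fun x => ?_⟩
    set t := 1 + ‖x‖ ^ 2 with ht
    have ht1 : 1 ≤ t := le_add_of_nonneg_right (sq_nonneg _)
    have ht0 : 0 < t := by linarith
    have h := par2 (S := t) (k := (B * (5 * t) ^ (-c)) ^ q) (by positivity) (fun y hy => by
      refine Real.rpow_le_rpow (by positivity) ((hbase y).trans' ?_) hq.le
      refine mul_le_mul_of_nonneg_left ?_ hB.le
      exact Real.rpow_le_rpow_of_nonpos (by positivity) (by linarith) (by linarith)) x
      (by linarith)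
    refine le_trans ?_ (Real.rpow_le_rpow (by positivity) h hp.le)
    have e : d2 * t * (B * (5 * t) ^ (-c)) ^ q
        = (d2 * (B * 5 ^ (-c)) ^ q) * t ^ (1 + (-c) * q) := by
      rw [Real.mul_rpow (by norm_num) ht0.le, ← mul_assoc, Real.mul_rpow (by positivity)
        (by positivity), ← Real.rpow_mul ht0.le, Real.rpow_add ht0, Real.rpow_one]
      ring
    rw [e, Real.mul_rpow (x := d2 * (B * 5 ^ (-c)) ^ q) (by positivity) (by positivity),
      ← Real.rpow_mul ht0.le]
    refine mul_le_mul_of_nonneg_left ?_ (by positivity)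
    exact Real.rpow_le_rpow_of_exponent_le ht1 (by nlinarith)
  obtain ⟨A, hA, hlog⟩ := hsup1.power_log_le hn hle1 hLam1 hc hc1 hu1 hpos1 hk hsource
  set κ := 1 / (c + 2) * (1 + 16 * σ) ^ (-c) with hκ
  have hκ0 : 0 < κ := by positivity
  set K := d1 * (1 / 2) * (d2 * 2 * κ ^ q) ^ p with hK
  have hK0 : 0 < K := by positivity
  have hbound : ∀ T : ℝ, 2 ≤ T → K * A ^ (p * q - 1) * Real.log T ^ (p * q - 1) ≤ 1 := by
    intro T hT
    have hT0 : 0 < T := by linarith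
    obtain ⟨z, hzS, hz⟩ := exists_min_norm_sq_le hu1 (S := T - 1) (by linarith)
    have hm := hpos1 z
    set m := u1 z
    have hdouble : ∀ x, ‖x‖ ^ 2 ≤ 16 * (T - 1) → κ * m ≤ u1 x := by
      intro x hx
      have h := hsup1.power_le hn hle1 hLam1 hc hc1 hu1 hpos1 hg1
        (by linarith : 0 < T - 1) hm hz x
      refine le_trans (le_of_eq_of_le ?_ (mul_le_mul_of_nonneg_left
        (Real.rpow_le_rpow_of_nonpos (y := 1 + 16 * σ) ?_ ?_ ?_) ?_)) h
      · rw [hκ]; ring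
      · have : 0 < T - 1 := by linarith
        positivity
      · have : 0 < T - 1 := by linarith
        have h2 : σ / (T - 1) * ‖x‖ ^ 2 ≤ σ / (T - 1) * (16 * (T - 1)) :=
          mul_le_mul_of_nonneg_left hx (by positivity)
        have h3 : σ / (T - 1) * (16 * (T - 1)) = 16 * σ := by field_simp
        linarith
      · linarith
      · positivity
    have h2 := par2 (S := 4 * (T - 1)) (k := (κ * m) ^ q) (by positivity) fun y hy =>
      Real.rpow_le_rpow (by positivity) (hdouble y (by linarith)) hq.le
    have h1 := par1 (S := T - 1) (k := (d2 * (2 * T) * (κ * m) ^ q) ^ p) (by positivity)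
      (fun y hy => Real.rpow_le_rpow (by positivity) ((h2 y hy).trans' (by
        gcongr d2 * ?_ * _
        linarith)) hp.le) z hzS
    have h3 : K * T ^ (p + 1) * m ^ (p * q - 1) * m ≤ 1 * m := by
      rw [one_mul]
      refine le_trans (le_of_eq_of_le ?_ (mul_le_mul_of_nonneg_right
        (mul_le_mul_of_nonneg_left (by linarith : T / 2 ≤ T - 1) hd1p.le) (by positivity))) h1
      have e1 : d2 * (2 * T) * (κ * m) ^ q = (d2 * 2 * κ ^ q) * T * m ^ q := by
        rw [Real.mul_rpow hκ0.le hm.le]; ring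
      rw [e1, Real.mul_rpow (by positivity) (by positivity), Real.mul_rpow (by positivity) hT0.le,
        ← Real.rpow_mul hm.le, mul_assoc _ (m ^ (p * q - 1)), ← Real.rpow_add_one hm.ne',
        Real.rpow_add_one hT0.ne', hK, sub_add_cancel, mul_comm q p]
      ring
    have h4 := le_of_mul_le_mul_right h3 hm
    have h5 : A * (T ^ (-c) * Real.log T) ≤ m := by
      refine le_trans (mul_le_mul_of_nonneg_left ?_ hA.le) (hlog z)
      refine le_trans ?_ (rpow_neg_mul_log_antitone hc (le_add_of_nonneg_right (sq_nonneg _))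
        (by linarith : 1 + ‖z‖ ^ 2 ≤ T))
      exact mul_le_mul_of_nonneg_left (le_add_of_nonneg_left (by positivity)) (by positivity)
    have hlT : 0 ≤ Real.log T := Real.log_nonneg (by linarith)
    have hr : 0 ≤ p * q - 1 := by linarith
    have h6 := Real.rpow_le_rpow (by positivity) h5 hr
    rw [Real.mul_rpow hA.le (by positivity), Real.mul_rpow (by positivity) hlT,
      ← Real.rpow_mul hT0.le] at h6
    have h7 : 1 ≤ T ^ (p + 1) * T ^ (-c * (p * q - 1)) := by
      rw [← Real.rpow_add hT0]
      exact Real.one_le_rpow (by linarith) (by linarith)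
    calc K * A ^ (p * q - 1) * Real.log T ^ (p * q - 1)
        ≤ K * A ^ (p * q - 1) * Real.log T ^ (p * q - 1)
          * (T ^ (p + 1) * T ^ (-c * (p * q - 1))) := le_mul_of_one_le_right (by positivity) h7
      _ = K * T ^ (p + 1)
          * (A ^ (p * q - 1) * (T ^ (-c * (p * q - 1)) * Real.log T ^ (p * q - 1))) := by ring
      _ ≤ K * T ^ (p + 1) * m ^ (p * q - 1) := mul_le_mul_of_nonneg_left h6 (by positivity)
      _ ≤ 1 := h4
  have hlim : Tendsto (fun T : ℝ => K * A ^ (p * q - 1) * Real.log T ^ (p * q - 1)) atTop atTop :=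
    ((tendsto_rpow_atTop (by linarith : 0 < p * q - 1)).comp
      Real.tendsto_log_atTop).const_mul_atTop (by positivity)
  obtain ⟨T, hT1, hT2⟩ := ((hlim.eventually_gt_atTop 1).and (eventually_ge_atTop 2)).exists
  exact (hbound T hT2).not_gt hT1

theorem stmt3 (n : ℕ) (hn : 2 ≤ n)
    (lam1 Lam1 lam2 Lam2 : ℝ) (hlam1 : 0 < lam1) (hLam1 : lam1 ≤ Lam1)
    (hlam2 : 0 < lam2) (hLam2 : lam2 ≤ Lam2)
    (N1 N2 : ℝ) (hN1 : N1 = lam1 / Lam1 * ((n : ℝ) - 1) + 1)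
    (hN2 : N2 = lam2 / Lam2 * ((n : ℝ) - 1) + 1)
    (hN1' : 2 < N1) (hN2' : 2 < N2)
    (p q : ℝ) (hp : 1 ≤ p) (hq : 1 ≤ q) (hpq : 1 < p * q)
    (hcrit : N1 - 2 ≤ 2 * (p + 1) / (p * q - 1) ∨ N2 - 2 ≤ 2 * (q + 1) / (p * q - 1))
    (u1 u2 : EuclideanSpace ℝ (Fin n) → ℝ)
    (hu1 : Continuous u1) (hu2 : Continuous u2)
    (hpos1 : ∀ x, 0 < u1 x) (hpos2 : ∀ x, 0 < u2 x)
    (hsuper1 : PucciSupersol lam1 Lam1 Set.univ u1 (fun x => u2 x ^ p))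
    (hsuper2 : PucciSupersol lam2 Lam2 Set.univ u2 (fun x => u1 x ^ q)) :
    False := by
  have hL1 : 0 < Lam1 := hlam1.trans_le hLam1
  have hL2 : 0 < Lam2 := hlam2.trans_le hLam2
  have hn0 : 0 < n := by omega
  have hN1e : Lam1 * N1 = lam1 * ((n : ℝ) - 1) + Lam1 := by rw [hN1]; field_simp
  have hN2e : Lam2 * N2 = lam2 * ((n : ℝ) - 1) + Lam2 := by rw [hN2]; field_simp
  have hpq0 : 0 < p * q - 1 := by linarith
  rcases hcrit with h | h
  · rw [le_div_iff₀ hpq0] at h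
    exact false_of_pucci_system (c := (N1 - 2) / 2) (N := N2) hn0 hL1 hL2 hLam1 hLam2
      (by linarith) (by linarith) (by rw [← hN1e]; ring) hN2e (by linarith) (by linarith) hpq
      (by linarith) hu1 hu2 hpos1 hpos2 hsuper1 hsuper2
  · rw [le_div_iff₀ hpq0] at h
    rw [mul_comm p q] at h hpq
    exact false_of_pucci_system (c := (N2 - 2) / 2) (N := N1) hn0 hL2 hL1 hLam2 hLam1
      (by linarith) (by linarith) (by rw [← hN2e]; ring) hN1e (by linarith) (by linarith) hpq
      (by linarith) hu2 hu1 hpos2 hpos1 hsuper2 hsuper1
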